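/- Let m > 0 and let f ∈ C²[0,1] satisfy |f″(x)| ≥ m for all x ∈ [0,1]. Then for every δ with 0 ≤ δ < 1, ω²_φ(f, δ) ≥ (m/4)·δ². In particular, for every natural number n ≥ 2, ω²_φ(f, 1/√n) ≥ (m/4)·(1/n). -/

import Mathlib

open Real Set Filter

/-- `φ(x) = √(x(1-x))`. -/
noncomputable def phi (x : ℝ) : ℝ := Real.sqrt (x * (1 - x))

/-- The Bernstein operator `B_n(f;x) = ∑_{k=0}^n f(k/n) C(n,k) x^k (1-x)^{n-k}`. -/
noncomputable def bern (n : ℕ) (f : ℝ → ℝ) (x : ℝ) : ℝ :=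
  ∑ k ∈ Finset.range (n + 1),
    f ((k : ℝ) / (n : ℝ)) * (n.choose k : ℝ) * x ^ k * (1 - x) ^ (n - k)

/-- The sup norm on `[0,1]`. -/
noncomputable def supNorm (g : ℝ → ℝ) : ℝ := sSup ((fun x => |g x|) '' Set.Icc 0 1)

/-- The second order Ditzian–Totik modulus of smoothness. -/
noncomputable def omega2phi (f : ℝ → ℝ) (δ : ℝ) : ℝ :=
  sSup {y : ℝ | ∃ h ∈ Set.Icc (0 : ℝ) δ,
    ∃ x ∈ Set.Icc (h ^ 2 / (1 + h ^ 2)) (1 / (1 + h ^ 2)),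
      y = |f (x + h * phi x) - 2 * f x + f (x - h * phi x)|}

/-- The usual first modulus of continuity on `[0,1]`. -/
noncomputable def omega1 (g : ℝ → ℝ) (δ : ℝ) : ℝ :=
  sSup {y : ℝ | ∃ x ∈ Set.Icc (0 : ℝ) 1, ∃ z ∈ Set.Icc (0 : ℝ) 1,
    |x - z| ≤ δ ∧ y = |g x - g z|}

/-- The usual second modulus of smoothness on `[0,1]`. -/
noncomputable def omega2 (g : ℝ → ℝ) (δ : ℝ) : ℝ :=
  sSup {y : ℝ | ∃ h : ℝ, 0 < h ∧ h ≤ δ ∧ ∃ x : ℝ, x ∈ Set.Icc (0 : ℝ) 1 ∧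
    x + 2 * h ∈ Set.Icc (0 : ℝ) 1 ∧ y = |g (x + 2 * h) - 2 * g (x + h) + g x|}

theorem second_diff_of_convex (f : ℝ → ℝ) (m : ℝ)
    (hf : ContDiffOn ℝ 2 f (Set.Icc 0 1))
    (hf2 : ∀ x ∈ Set.Icc (0 : ℝ) 1, m ≤ iteratedDerivWithin 2 f (Set.Icc 0 1) x)
    (δ : ℝ) (h0 : 0 ≤ δ) (h1 : δ ≤ 1) :
    m / 4 * δ ^ 2 ≤ f (1/2 + δ * (1/2)) - 2 * f (1/2) + f (1/2 - δ * (1/2)) := by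
  have hu : UniqueDiffOn ℝ (Set.Icc (0:ℝ) 1) := uniqueDiffOn_Icc one_pos
  have hd1 : DifferentiableOn ℝ f (Set.Icc 0 1) := hf.differentiableOn (by norm_num)
  have hd2 : DifferentiableOn ℝ (derivWithin f (Set.Icc 0 1)) (Set.Icc 0 1) := by
    have := hf.differentiableOn_iteratedDerivWithin (m := 1) (by norm_num) hu
    rwa [iteratedDerivWithin_one] at this
  have hc : ConvexOn ℝ (Set.Icc 0 1) (fun x => f x - m / 2 * x ^ 2) := by
    refine convexOn_of_hasDerivWithinAt2_nonneg (f' := fun x => derivWithin f (Set.Icc 0 1) x - m * x)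
      (f'' := fun x => iteratedDerivWithin 2 f (Set.Icc 0 1) x - m) (convex_Icc 0 1) ?_ ?_ ?_ ?_
    · exact hf.continuousOn.sub (by fun_prop)
    · intro x hx
      have hx' := interior_subset hx
      have := ((hd1 x hx').hasDerivWithinAt.mono interior_subset).sub
        ((((hasDerivAt_id x).pow 2).const_mul (m/2)).hasDerivWithinAt (s := interior (Set.Icc 0 1)))
      refine this.congr_deriv ?_
      simp
      ring
    · intro x hx
      have hx' := interior_subset hx
      have := ((hd2 x hx').hasDerivWithinAt.mono interior_subset).sub
        (((hasDerivAt_id x).const_mul m).hasDerivWithinAt (s := interior (Set.Icc 0 1)))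
      refine this.congr_deriv ?_
      rw [iteratedDerivWithin_succ, iteratedDerivWithin_one]
      simp
    · intro x hx
      have := hf2 x (interior_subset hx)
      simpa using this
  have ha : (1/2 + δ * (1/2)) ∈ Set.Icc (0:ℝ) 1 := ⟨by linarith, by linarith⟩
  have hb : (1/2 - δ * (1/2)) ∈ Set.Icc (0:ℝ) 1 := ⟨by linarith, by linarith⟩
  have := hc.2 ha hb (show (0:ℝ) ≤ 1/2 by norm_num) (show (0:ℝ) ≤ 1/2 by norm_num) (by norm_num)
  simp only [smul_eq_mul] at this
  rw [show (1:ℝ)/2 * (1/2 + δ * (1/2)) + 1/2 * (1/2 - δ * (1/2)) = 1/2 by ring] at this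
  nlinarith [this]

theorem phi_bounds (h x : ℝ) (h0 : 0 ≤ h)
    (hx : x ∈ Set.Icc (h ^ 2 / (1 + h ^ 2)) (1 / (1 + h ^ 2))) :
    x ∈ Set.Icc (0:ℝ) 1 ∧ x + h * phi x ∈ Set.Icc (0:ℝ) 1 ∧ x - h * phi x ∈ Set.Icc (0:ℝ) 1 := by
  have hp : 0 < 1 + h ^ 2 := by positivity
  obtain ⟨hl, hr⟩ := hx
  have hx0 : 0 ≤ x := le_trans (by positivity) hl
  rw [div_le_iff₀ hp] at hl
  rw [le_div_iff₀ hp] at hr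
  have hx1 : x ≤ 1 := by nlinarith [mul_nonneg hx0 (sq_nonneg h)]
  have hs : phi x ^ 2 = x * (1 - x) := Real.sq_sqrt (mul_nonneg hx0 (by linarith))
  have hph : 0 ≤ phi x := Real.sqrt_nonneg _
  have hhp : 0 ≤ h * phi x := mul_nonneg h0 hph
  have hA : h * phi x ≤ x := by
    refine abs_le_of_sq_le_sq' ?_ hx0 |>.2
    rw [mul_pow, hs]
    nlinarith [mul_nonneg hx0 (show 0 ≤ x * (1 + h^2) - h^2 by linarith)]
  have hB : h * phi x ≤ 1 - x := by
    refine abs_le_of_sq_le_sq' ?_ (by linarith) |>.2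
    rw [mul_pow, hs]
    nlinarith [mul_nonneg (show 0 ≤ 1 - x by linarith) (show 0 ≤ 1 - x * (1 + h^2) by linarith)]
  exact ⟨⟨hx0, hx1⟩, ⟨by linarith, by linarith⟩, ⟨by linarith, by linarith⟩⟩

/-- If `f ∈ C²[0,1]` with `|f''(x)| ≥ m > 0` on `[0,1]`, then `ω²_φ(f,δ) ≥ (m/4)δ²` for
`0 ≤ δ < 1`; in particular `ω²_φ(f,1/√n) ≥ (m/4)(1/n)` for all `n ≥ 2`. -/
theorem lower_modulus_estimate_from_second_derivative
    (f : ℝ → ℝ) (m : ℝ) (hm : 0 < m)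
    (hf : ContDiffOn ℝ 2 f (Set.Icc 0 1))
    (hf2 : ∀ x ∈ Set.Icc (0 : ℝ) 1, m ≤ |iteratedDerivWithin 2 f (Set.Icc 0 1) x|) :
    (∀ δ : ℝ, 0 ≤ δ → δ < 1 → m / 4 * δ ^ 2 ≤ omega2phi f δ) ∧
    (∀ n : ℕ, 2 ≤ n → m / 4 * (1 / n) ≤ omega2phi f (1 / Real.sqrt n)) := by
  have main : ∀ δ : ℝ, 0 ≤ δ → δ < 1 → m / 4 * δ ^ 2 ≤ omega2phi f δ := by
    intro δ h0 h1
    have hu : UniqueDiffOn ℝ (Set.Icc (0:ℝ) 1) := uniqueDiffOn_Icc one_pos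
    have hbdd : BddAbove {y : ℝ | ∃ h ∈ Set.Icc (0 : ℝ) δ,
        ∃ x ∈ Set.Icc (h ^ 2 / (1 + h ^ 2)) (1 / (1 + h ^ 2)),
        y = |f (x + h * phi x) - 2 * f x + f (x - h * phi x)|} := by
      obtain ⟨C, hC⟩ := isCompact_Icc.exists_bound_of_continuousOn hf.continuousOn
      refine ⟨4 * C, ?_⟩
      rintro y ⟨h, hh, x, hx, rfl⟩
      obtain ⟨hx1, hx2, hx3⟩ := phi_bounds h x hh.1 hx
      have e1 := abs_le.1 (hC _ hx1)
      have e2 := abs_le.1 (hC _ hx2)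
      have e3 := abs_le.1 (hC _ hx3)
      rw [abs_le]
      constructor <;> linarith [e1.1, e1.2, e2.1, e2.2, e3.1, e3.2]
    have hphi : phi (1/2) = 1/2 := by
      unfold phi
      rw [show (1/2:ℝ) * (1 - 1/2) = (1/2)^2 by norm_num]
      exact Real.sqrt_sq (by norm_num)
    have hmem : |f (1/2 + δ * (1/2)) - 2 * f (1/2) + f (1/2 - δ * (1/2))| ≤ omega2phi f δ := by
      refine le_csSup hbdd ⟨δ, ⟨h0, le_rfl⟩, 1/2, ⟨?_, ?_⟩, by rw [hphi]⟩
      · rw [div_le_iff₀ (by positivity)]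
        nlinarith
      · rw [le_div_iff₀ (by positivity)]
        nlinarith
    refine le_trans ?_ hmem
    have hcont := hf.continuousOn_iteratedDerivWithin (m := 2) le_rfl hu
    have hsign : (∀ x ∈ Set.Icc (0:ℝ) 1, m ≤ iteratedDerivWithin 2 f (Set.Icc 0 1) x) ∨
        (∀ x ∈ Set.Icc (0:ℝ) 1, m ≤ - iteratedDerivWithin 2 f (Set.Icc 0 1) x) := by
      by_contra! hcon
      obtain ⟨⟨a, ha, ha'⟩, b, hb, hb'⟩ := hcon
      have h1 : iteratedDerivWithin 2 f (Set.Icc 0 1) a ≤ 0 := by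
        rcases le_abs.1 (hf2 a ha) with h | h <;> linarith
      have h2 : 0 ≤ iteratedDerivWithin 2 f (Set.Icc 0 1) b := by
        rcases le_abs.1 (hf2 b hb) with h | h <;> linarith
      obtain ⟨c, hc, hc'⟩ := isPreconnected_Icc.intermediate_value ha hb hcont ⟨h1, h2⟩
      have := hf2 c hc
      rw [hc', abs_zero] at this
      linarith
    rcases hsign with hs | hs
    · exact (second_diff_of_convex f m hf hs δ h0 h1.le).trans (le_abs_self _)
    · have := second_diff_of_convex (fun x => - f x) m hf.neg (fun x hx => by
        rw [iteratedDerivWithin_fun_neg]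
        exact hs x hx) δ h0 h1.le
      refine le_trans ?_ (neg_le_abs _)
      linarith
  refine ⟨main, fun n hn => ?_⟩
  have hn' : (2:ℝ) ≤ n := by exact_mod_cast hn
  have h1 : 1 < Real.sqrt n := by
    rw [Real.lt_sqrt (by norm_num)]
    linarith
  have := main (1 / Real.sqrt n) (by positivity) (by rw [div_lt_one (by linarith)]; exact h1)
  rwa [div_pow, one_pow, Real.sq_sqrt (by linarith)] at this
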